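/- Let G be a finite simple graph on n vertices in which every vertex has positive degree, and let v_1, …, v_n be an orthonormal basis of ℝ^n consisting of eigenvectors of the normalized Laplacian L with L v_i = λ_i v_i. Let K = Σ_{i : λ_i ≠ 0} 1/λ_i be Kemeny's constant and, for a pair of vertices {x,y}, let dK/d{x,y} := Σ_{i : λ_i ≠ 0} −(1/λ_i²)·F(v_i, λ_i, {x,y}). Then for any two vertices x, y of G, Σ_{i : λ_i ≠ 0} (−2/λ_i²) + K ≤ dK/d{x,y} ≤ K. -/

import Mathlib

open Finset

variable {V : Type*} [Fintype V] [DecidableEq V]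

/-- The normalized Laplacian `L = I - D^{-1/2} A D^{-1/2}` of a simple graph. -/
noncomputable def normLap (G : SimpleGraph V) [DecidableRel G.Adj] : Matrix V V ℝ :=
  fun x y =>
    if x = y then 1
    else if G.Adj x y then -(1 / Real.sqrt ((G.degree x : ℝ) * (G.degree y : ℝ)))
    else 0

/-- The Aksoy–Purvine–Young edge-derivative expression
`F(v, λ, {x,y}) = (1-λ)(v_x²/d_x + v_y²/d_y) − 2 v_x v_y / √(d_x d_y)`. -/
noncomputable def edgeDeriv (G : SimpleGraph V) [DecidableRel G.Adj]
    (v : V → ℝ) (lam : ℝ) (x y : V) : ℝ :=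
  (1 - lam) * (v x ^ 2 / (G.degree x : ℝ) + v y ^ 2 / (G.degree y : ℝ))
    - 2 * (v x * v y) / Real.sqrt ((G.degree x : ℝ) * (G.degree y : ℝ))

/-- The edge derivative of Kemeny's constant with respect to the pair `{x,y}`:
`dK/d{x,y} = Σ_{i : λ_i ≠ 0} −(1/λ_i²) F(v_i, λ_i, {x,y})`. -/
noncomputable def kemenyDeriv (G : SimpleGraph V) [DecidableRel G.Adj] {n : ℕ}
    (w : Fin n → V → ℝ) (lam : Fin n → ℝ) (x y : V) : ℝ :=
  ∑ i, if lam i = 0 then 0 else -(1 / lam i ^ 2) * edgeDeriv G (w i) (lam i) x y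

/-- The data of the normalized eigenvectors `g i z = w i z / √d_z`. -/
structure KData (G : SimpleGraph V) [DecidableRel G.Adj] {n : ℕ}
    (g : Fin n → V → ℝ) (lam : Fin n → ℝ) : Prop where
  deg : ∀ z : V, (1 : ℝ) ≤ G.degree z
  orth : ∀ i j, (∑ z, (G.degree z : ℝ) * (g i z * g j z)) = if i = j then 1 else 0
  dual : ∀ z, ∑ i, (G.degree z : ℝ) * g i z ^ 2 = 1
  dual0 : ∀ z u, z ≠ u → ∑ i, g i z * g i u = 0
  eig : ∀ i z, ∑ u ∈ G.neighborFinset z, g i u = (1 - lam i) * (G.degree z * g i z)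

noncomputable def KM (G : SimpleGraph V) [DecidableRel G.Adj] {n : ℕ}
    (g : Fin n → V → ℝ) (lam : Fin n → ℝ) (z : V) : ℝ :=
  ∑ i, if lam i = 0 then 0 else (G.degree z : ℝ) * g i z ^ 2 / lam i

noncomputable def KC {n : ℕ}
    (g : Fin n → V → ℝ) (lam : Fin n → ℝ) (z : V) : ℝ :=
  ∑ i, if lam i = 0 then g i z ^ 2 else 0

section
variable {G : SimpleGraph V} [DecidableRel G.Adj] {n : ℕ}
    {g : Fin n → V → ℝ} {lam : Fin n → ℝ}

theorem KData.norm (h : KData G g lam) (i) : ∑ z, (G.degree z : ℝ) * g i z ^ 2 = 1 := by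
  have := h.orth i i
  simpa [pow_two] using this

theorem sum_nbr_swap (f : V → V → ℝ) :
    ∑ z, ∑ u ∈ G.neighborFinset z, f z u = ∑ z, ∑ u ∈ G.neighborFinset z, f u z := by
  rw [Finset.sum_comm' (s' := fun u => G.neighborFinset u) (t' := Finset.univ)]
  intro x y
  simp [G.adj_comm]

theorem KData.quad (h : KData G g lam) (i) (s : ℝ) (hs : s ^ 2 = 1) :
    ∑ z, ∑ u ∈ G.neighborFinset z, (g i z - s * g i u) ^ 2 = 2 - 2 * s * (1 - lam i) := by
  have e1 : ∑ z, ∑ u ∈ G.neighborFinset z, g i z ^ 2 = 1 := by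
    rw [← h.norm i]
    simp
  have e2 : ∑ z, ∑ u ∈ G.neighborFinset z, g i u ^ 2 = 1 := by
    rw [← sum_nbr_swap (fun z u => g i z ^ 2)]; exact e1
  have e3 : ∑ z, ∑ u ∈ G.neighborFinset z, g i z * g i u = 1 - lam i := by
    simp_rw [← Finset.mul_sum, h.eig]
    calc _ = ∑ z, (1 - lam i) * ((G.degree z : ℝ) * g i z ^ 2) := by
            apply Finset.sum_congr rfl; intros; ring
      _ = _ := by rw [← Finset.mul_sum, h.norm i, mul_one]
  have : ∀ z u, (g i z - s * g i u) ^ 2 = g i z ^ 2 + g i u ^ 2 - 2 * s * (g i z * g i u) := by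
    intro z u
    linear_combination (g i u ^ 2) * hs
  simp_rw [this, Finset.sum_sub_distrib, Finset.sum_add_distrib, ← Finset.mul_sum]
  simp_rw [← Finset.mul_sum] at e3
  rw [e1, e2, e3]; ring

theorem KData.nonneg (h : KData G g lam) (i) : 0 ≤ lam i := by
  have := h.quad i 1 (by norm_num)
  have h2 : 0 ≤ ∑ z, ∑ u ∈ G.neighborFinset z, (g i z - 1 * g i u) ^ 2 := by positivity
  linarith

theorem KData.le_two (h : KData G g lam) (i) : lam i ≤ 2 := by
  have := h.quad i (-1) (by norm_num)
  have h2 : 0 ≤ ∑ z, ∑ u ∈ G.neighborFinset z, (g i z - (-1) * g i u) ^ 2 := by positivity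
  linarith

theorem KData.ker (h : KData G g lam) (i) (hi : lam i = 0) {z u : V} (hzu : G.Adj z u) :
    g i u = g i z := by
  have := h.quad i 1 (by norm_num)
  rw [hi] at this
  norm_num at this
  rw [Finset.sum_eq_zero_iff_of_nonneg (fun _ _ => by positivity)] at this
  have h1 := this z (Finset.mem_univ _)
  rw [Finset.sum_eq_zero_iff_of_nonneg (fun _ _ => by positivity)] at h1
  have h2 := h1 u (by simpa using hzu)
  have := pow_eq_zero_iff (two_ne_zero) |>.1 h2
  linarith

theorem KData.c_adj (h : KData G g lam) {z u : V} (hzu : G.Adj z u) :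
    KC g lam u = KC g lam z := by
  unfold KC
  apply Finset.sum_congr rfl
  intro i _
  split_ifs with hi
  · rw [h.ker i hi hzu]
  · rfl

theorem KC_nonneg (z : V) : 0 ≤ KC g lam z := by
  unfold KC
  apply Finset.sum_nonneg
  intro i _
  split_ifs <;> positivity

theorem KData.c_sum (h : KData G g lam) (y : V) :
    ((G.degree y : ℝ) + ∑ z ∈ G.neighborFinset y, (G.degree z : ℝ)) * KC g lam y ≤ 1 := by
  set c := KC g lam y with hc
  set a : Fin n → ℝ := fun i => if lam i = 0 then g i y else 0 with ha
  set k : V → ℝ := fun z => ∑ i, a i * g i z with hk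
  have hca : c = ∑ i, a i * a i := by
    rw [hc]; unfold KC; apply Finset.sum_congr rfl
    intro i _
    simp only [ha]; split_ifs <;> ring
  have hky : k y = c := by
    rw [hca]; apply Finset.sum_congr rfl
    intro i _
    simp only [ha]; split_ifs <;> ring
  have hkn : ∀ z ∈ G.neighborFinset y, k z = c := by
    intro z hz
    rw [← hky]; apply Finset.sum_congr rfl
    intro i _
    simp only [ha]; split_ifs with hi
    · rw [h.ker i hi (show G.Adj y z by simpa using hz)]
    · ring
  have hnorm : ∑ z, (G.degree z : ℝ) * k z ^ 2 = c := by
    have : ∀ z, (G.degree z : ℝ) * k z ^ 2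
        = ∑ i, ∑ j, (a i * a j) * ((G.degree z : ℝ) * (g i z * g j z)) := by
      intro z
      simp only [hk]
      rw [pow_two, Finset.sum_mul_sum, Finset.mul_sum]
      apply Finset.sum_congr rfl; intro i _
      rw [Finset.mul_sum]
      apply Finset.sum_congr rfl; intro j _
      ring
    simp_rw [this]
    rw [Finset.sum_comm, hca]
    apply Finset.sum_congr rfl; intro i _
    rw [Finset.sum_comm]
    simp_rw [← Finset.mul_sum, h.orth]
    simp
  have hsub : ∑ z ∈ insert y (G.neighborFinset y), (G.degree z : ℝ) * k z ^ 2 ≤ c := by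
    rw [← hnorm]
    apply Finset.sum_le_sum_of_subset_of_nonneg (Finset.subset_univ _)
    intros; positivity
  rw [Finset.sum_insert (by simp), hky,
    Finset.sum_congr rfl (fun z hz => by rw [hkn z hz]), ← Finset.sum_mul] at hsub
  have h0 : 0 ≤ c := KC_nonneg y
  rcases h0.eq_or_lt with h0 | h0
  · rw [← h0]; simp
  · by_contra hcon
    push Not at hcon
    nlinarith

theorem KData.p_half (h : KData G g lam) (y : V) : G.degree y * KC g lam y ≤ 1 / 2 := by
  have h1 := h.c_sum y
  have h2 : (G.degree y : ℝ) ≤ ∑ z ∈ G.neighborFinset y, (G.degree z : ℝ) := by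
    calc (G.degree y : ℝ) = ∑ z ∈ G.neighborFinset y, (1 : ℝ) := by simp
      _ ≤ _ := Finset.sum_le_sum (fun z _ => h.deg z)
  have h0 : 0 ≤ KC g lam y := KC_nonneg y
  nlinarith

theorem KData.lsum (h : KData G g lam) (z : V) :
    ∑ i, lam i * ((G.degree z : ℝ) * g i z ^ 2) = 1 := by
  have e : ∑ i, g i z * ∑ u ∈ G.neighborFinset z, g i u = 0 := by
    simp_rw [Finset.mul_sum]
    rw [Finset.sum_comm]
    apply Finset.sum_eq_zero
    intro u hu
    apply h.dual0
    rintro rfl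
    simp at hu
  simp_rw [h.eig] at e
  have := h.dual z
  have e2 : ∑ i, g i z * ((1 - lam i) * (G.degree z * g i z))
    = ∑ i, (G.degree z : ℝ) * g i z ^ 2 - ∑ i, lam i * ((G.degree z : ℝ) * g i z ^ 2) := by
    rw [← Finset.sum_sub_distrib]
    apply Finset.sum_congr rfl; intros; ring
  linarith

theorem KM_nonneg (h : KData G g lam) (z : V) : 0 ≤ KM G g lam z := by
  unfold KM
  apply Finset.sum_nonneg
  intro i _
  have := h.nonneg i
  split_ifs <;> positivity

theorem KData.m_lower (h : KData G g lam) (z : V) :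
    3 / 4 - G.degree z * KC g lam z ≤ KM G g lam z := by
  have e : 3 / 4 - G.degree z * KC g lam z = ∑ i, ((G.degree z : ℝ) * g i z ^ 2
      - (1 / 4) * (lam i * ((G.degree z : ℝ) * g i z ^ 2))
      - G.degree z * (if lam i = 0 then g i z ^ 2 else 0)) := by
    rw [Finset.sum_sub_distrib, Finset.sum_sub_distrib, ← Finset.mul_sum (a := (1 / 4 : ℝ)),
      h.lsum, h.dual, ← Finset.mul_sum]
    unfold KC
    ring
  rw [e]; unfold KM
  apply Finset.sum_le_sum
  intro i _
  split_ifs with hi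
  · rw [hi]; linarith
  · have hp : 0 < lam i := lt_of_le_of_ne (h.nonneg i) (Ne.symm hi)
    rw [le_div_iff₀ hp]
    have : 0 ≤ (G.degree z : ℝ) * g i z ^ 2 := by positivity
    nlinarith [mul_nonneg this (sq_nonneg (1 - lam i / 2))]

theorem KData.m_quarter (h : KData G g lam) (z : V) : 1 / 4 ≤ KM G g lam z := by
  linarith [h.m_lower z, h.p_half z]

/-- eigen-equation at a leaf -/
theorem KData.leaf_eq (h : KData G g lam) {x y : V} (hx : G.neighborFinset x = {y}) (i) :
    g i y = (1 - lam i) * g i x := by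
  have := h.eig i x
  rw [← G.card_neighborFinset_eq_degree, hx] at this
  simpa using this

theorem KData.leaf_m (h : KData G g lam) {x y : V} (hx : G.neighborFinset x = {y}) :
    KM G g lam x = KM G g lam y / G.degree y + 1 - 2 * KC g lam x := by
  have dx : (G.degree x : ℝ) = 1 := by
    rw [← G.card_neighborFinset_eq_degree, hx]; simp
  have dy := h.deg y
  have e : KM G g lam y / G.degree y + 1 - 2 * KC g lam x = ∑ i,
     ((if lam i = 0 then 0 else (G.degree y : ℝ) * g i y ^ 2 / lam i) / G.degree y
      + 2 * ((G.degree x : ℝ) * g i x ^ 2) - lam i * ((G.degree x : ℝ) * g i x ^ 2)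
      - 2 * (if lam i = 0 then g i x ^ 2 else 0)) := by
    rw [Finset.sum_sub_distrib, Finset.sum_sub_distrib, Finset.sum_add_distrib,
      ← Finset.mul_sum (a := (2 : ℝ)), ← Finset.mul_sum (a := (2 : ℝ)), h.lsum, h.dual,
      ← Finset.sum_div]
    unfold KC KM
    ring
  rw [e]; unfold KM
  apply Finset.sum_congr rfl
  intro i _
  rw [h.leaf_eq hx i, dx]
  split_ifs with hi
  · rw [hi]; ring
  · have : (G.degree y : ℝ) ≠ 0 := by linarith
    field_simp
    ring

theorem KData.leaf (h : KData G g lam) {x y : V} (hx : G.neighborFinset x = {y}) :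
    2 * KM G g lam x ≤ ∑ z, KM G g lam z := by
  have key : ∀ s : Finset V, ∑ z ∈ s, KM G g lam z ≤ ∑ z, KM G g lam z := fun s =>
    Finset.sum_le_sum_of_subset_of_nonneg (Finset.subset_univ _) (fun z _ _ => KM_nonneg h z)
  have hxy : G.Adj x y := by
    have : y ∈ G.neighborFinset x := by rw [hx]; simp
    simpa using this
  have hne := hxy.ne
  have hxonly : ∀ z, G.Adj x z → z = y := by
    intro z hz
    have : z ∈ G.neighborFinset x := by simpa using hz
    rw [hx] at this; simpa using this
  have hm := h.leaf_m hx
  have dx : (G.degree x : ℝ) = 1 := by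
    rw [← G.card_neighborFinset_eq_degree, hx]; simp
  set p := KC g lam x with hp
  have hpy : KC g lam y = p := h.c_adj hxy
  have hp0 : 0 ≤ p := KC_nonneg x
  have my := h.m_lower y
  have py := h.p_half y
  rw [hpy] at my py
  have hxN : x ∈ G.neighborFinset y := by simpa using hxy.symm
  obtain hd | hd | hd : G.degree y = 1 ∨ G.degree y = 2 ∨ 3 ≤ G.degree y := by
    have := h.deg y
    have : 1 ≤ G.degree y := by exact_mod_cast this
    omega
  · have hy : G.neighborFinset y = {x} := by
      rw [← G.card_neighborFinset_eq_degree, Finset.card_eq_one] at hd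
      obtain ⟨a, ha⟩ := hd
      rw [ha] at hxN ⊢
      simp at hxN; rw [hxN]
    have hm2 := h.leaf_m hy
    rw [dx, hpy] at hm2
    rw [hd] at hm
    have := key {x, y}
    rw [Finset.sum_pair hne] at this
    norm_num at hm hm2
    linarith
  · rw [hd] at my py hm
    norm_num at my py hm
    have hc : (G.neighborFinset y \ {x}).card = 1 := by
      rw [Finset.card_sdiff_of_subset (by simpa using hxN), G.card_neighborFinset_eq_degree, hd]
      simp
    obtain ⟨z, hz⟩ := Finset.card_eq_one.1 hc
    have hz1 : z ∈ G.neighborFinset y \ {x} := by rw [hz]; simp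
    simp at hz1
    obtain ⟨hyz, hzx⟩ := hz1
    have hzc : KC g lam z = p := by rw [h.c_adj hyz, hpy]
    have mz := h.m_lower z
    rw [hzc] at mz
    have hyzN : y ∈ G.neighborFinset z := by simpa using hyz.symm
    have hc2 : (G.neighborFinset z \ {y}).card = G.degree z - 1 := by
      rw [Finset.card_sdiff_of_subset (by simpa using hyzN), G.card_neighborFinset_eq_degree]
      simp
    have hprop : ∀ t ∈ G.neighborFinset z \ {y}, t ≠ y ∧ t ≠ x ∧ t ≠ z := by
      intro t ht
      simp at ht
      refine ⟨ht.2, ?_, ht.1.ne'⟩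
      rintro rfl
      exact hyz.ne (hxonly z ht.1.symm).symm
    obtain he | he | he : G.degree z = 1 ∨ G.degree z = 2 ∨ 3 ≤ G.degree z := by
      have := h.deg z
      have : 1 ≤ G.degree z := by exact_mod_cast this
      omega
    · rw [he] at mz
      norm_num at mz
      have := key {x, y, z}
      rw [Finset.sum_insert (by simp [hne, Ne.symm hzx]), Finset.sum_pair hyz.ne] at this
      linarith
    · rw [he] at mz hc2
      norm_num at mz hc2
      obtain ⟨t, ht⟩ := Finset.card_eq_one.1 hc2
      obtain ⟨h1, h2, h3⟩ := hprop t (by rw [ht]; simp)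
      have mt := h.m_quarter t
      have := key {x, y, z, t}
      rw [Finset.sum_insert (by simp [hne, Ne.symm hzx, Ne.symm h2]),
        Finset.sum_insert (by simp [hyz.ne, Ne.symm h1]), Finset.sum_pair h3.symm] at this
      linarith
    · obtain ⟨t, ht, s, hs, hts⟩ := Finset.one_lt_card.1
        (show 1 < (G.neighborFinset z \ {y}).card by omega)
      obtain ⟨h1, h2, h3⟩ := hprop t ht
      obtain ⟨k1, k2, k3⟩ := hprop s hs
      have mt := h.m_quarter t
      have ms := h.m_quarter s
      have mz := h.m_quarter z
      have := key {x, y, z, t, s}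
      rw [Finset.sum_insert (by simp [hne, Ne.symm hzx, Ne.symm h2, Ne.symm k2]),
        Finset.sum_insert (by simp [hyz.ne, Ne.symm h1, Ne.symm k1]),
        Finset.sum_insert (by simp [Ne.symm h3, Ne.symm k3]), Finset.sum_pair hts] at this
      linarith
  · have hk := key (insert y (G.neighborFinset y))
    rw [Finset.sum_insert (by simp), ← Finset.add_sum_erase _ _ hxN] at hk
    have hs := h.c_sum y
    rw [hpy, ← Finset.add_sum_erase _ _ hxN, dx] at hs
    have hl : ∑ z ∈ (G.neighborFinset y).erase x, (3 / 4 - G.degree z * p)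
        ≤ ∑ z ∈ (G.neighborFinset y).erase x, KM G g lam z := by
      apply Finset.sum_le_sum
      intro z hz
      have hyz : G.Adj y z := by simpa using Finset.mem_of_mem_erase hz
      have := h.m_lower z
      rwa [h.c_adj hyz, hpy] at this
    rw [Finset.sum_sub_distrib, ← Finset.sum_mul, Finset.sum_const,
      Finset.card_erase_of_mem hxN, G.card_neighborFinset_eq_degree, nsmul_eq_mul,
      Nat.cast_sub (by omega)] at hl
    push_cast at hl
    have hd3 : (3 : ℝ) ≤ G.degree y := by exact_mod_cast hd
    set d : ℝ := (G.degree y : ℝ)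
    set S := ∑ z ∈ (G.neighborFinset y).erase x, (G.degree z : ℝ)
    set m := KM G g lam y
    have hinv : 1 / d ≤ 1 / 3 := one_div_le_one_div_of_le (by norm_num) hd3
    have hdd : 1 / d * d = 1 := by field_simp
    have hmd : m / d = m * (1 / d) := by ring
    rw [hmd] at hm
    have h1 : (1 - 1 / d) * (3 / 4 - d * p) ≤ (1 - 1 / d) * m :=
      mul_le_mul_of_nonneg_left my (by linarith)
    have h2 : (1 - 1 / d) * (3 / 4 - d * p) = 3 / 4 - 3 / 4 * (1 / d) - d * p + p := by
      linear_combination p * hdd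
    nlinarith

theorem KData.trace (h : KData G g lam) :
    ∑ z, KM G g lam z = ∑ i, if lam i = 0 then (0 : ℝ) else 1 / lam i := by
  unfold KM
  rw [Finset.sum_comm]
  apply Finset.sum_congr rfl
  intro i _
  split_ifs
  · simp
  · rw [← Finset.sum_div, h.norm]

theorem KData.diag (h : KData G g lam) (x : V) :
    (∑ i, if lam i = 0 then (0 : ℝ) else 2 * g i x ^ 2 / lam i) ≤
      ∑ i, if lam i = 0 then (0 : ℝ) else 1 / lam i := by
  rw [← h.trace]
  have dx := h.deg x
  have e : (∑ i, if lam i = 0 then (0 : ℝ) else 2 * g i x ^ 2 / lam i)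
      = 2 / G.degree x * KM G g lam x := by
    unfold KM
    rw [Finset.mul_sum]
    apply Finset.sum_congr rfl
    intro i _
    split_ifs
    · simp
    · have : (G.degree x : ℝ) ≠ 0 := by linarith
      field_simp
  rw [e]
  have m0 := KM_nonneg h x
  by_cases hd : G.degree x = 1
  · rw [hd]
    have hc := hd
    rw [← G.card_neighborFinset_eq_degree, Finset.card_eq_one] at hc
    obtain ⟨y, hy⟩ := hc
    have := h.leaf hy
    norm_num
    linarith
  · have : (2 : ℝ) ≤ G.degree x := by
      have : 1 ≤ G.degree x := by exact_mod_cast dx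
      have : 2 ≤ G.degree x := by omega
      exact_mod_cast this
    have h1 : 2 / (G.degree x : ℝ) ≤ 1 := by
      rw [div_le_one (by linarith)]; exact this
    have h2 : KM G g lam x ≤ ∑ z, KM G g lam z :=
      Finset.single_le_sum (fun z _ => KM_nonneg h z) (Finset.mem_univ x)
    nlinarith

end

theorem kdata_of (G : SimpleGraph V) [DecidableRel G.Adj]
    (hdeg : ∀ z : V, 0 < G.degree z)
    (w : Fin (Fintype.card V) → V → ℝ) (lam : Fin (Fintype.card V) → ℝ)
    (horth : ∀ i j, (∑ z, w i z * w j z) = if i = j then 1 else 0)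
    (heig : ∀ i, (normLap G).mulVec (w i) = lam i • w i) :
    KData G (fun i z => w i z / Real.sqrt (G.degree z)) lam := by
  have hd : ∀ z, (1 : ℝ) ≤ G.degree z := fun z => by exact_mod_cast hdeg z
  have hs : ∀ z, 0 < Real.sqrt (G.degree z) := fun z => Real.sqrt_pos.2 (by linarith [hd z])
  have hss : ∀ z, Real.sqrt (G.degree z) * Real.sqrt (G.degree z) = G.degree z :=
    fun z => Real.mul_self_sqrt (by linarith [hd z])
  have hdual : ∀ z u, ∑ i, w i z * w i u = if z = u then 1 else 0 := by
    have h1 : (Matrix.of w) * (Matrix.of w).transpose = 1 := by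
      ext i j
      simp [Matrix.mul_apply, horth, Matrix.one_apply]
    have h2 : (Matrix.of w).transpose * (Matrix.of w) = 1 :=
      (Matrix.mul_eq_one_comm_of_card_eq _ _ _ (by simp)).1 h1
    intro z u
    have := congrFun (congrFun h2 z) u
    simpa [Matrix.mul_apply, Matrix.one_apply] using this
  refine ⟨hd, ?_, ?_, ?_, ?_⟩
  · intro i j
    rw [← horth]
    apply Finset.sum_congr rfl
    intro z _
    have := (hs z).ne'
    rw [← hss z]
    simp only [hss z]
    rw [div_mul_div_comm, hss z]
    have : (G.degree z : ℝ) ≠ 0 := by linarith [hd z]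
    field_simp
  · intro z
    have := hdual z z
    simp only [if_true] at this
    rw [← this]
    apply Finset.sum_congr rfl
    intro i _
    rw [div_pow, Real.sq_sqrt (by linarith [hd z])]
    have : (G.degree z : ℝ) ≠ 0 := by linarith [hd z]
    field_simp
  · intro z u hzu
    have := hdual z u
    rw [if_neg hzu] at this
    simp_rw [div_mul_div_comm]
    rw [← Finset.sum_div, this, zero_div]
  · intro i z
    have h1 := congrFun (heig i) z
    have h2 : (normLap G).mulVec (w i) z = w i z -
        (∑ u ∈ G.neighborFinset z, w i u / Real.sqrt (G.degree u)) / Real.sqrt (G.degree z) := by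
      have : ∀ u, normLap G z u * w i u = (if z = u then w i u else 0) -
          (if u ∈ G.neighborFinset z then
            w i u / Real.sqrt (G.degree u) / Real.sqrt (G.degree z) else 0) := by
        intro u
        unfold normLap
        by_cases hzu : z = u
        · subst hzu; simp
        · by_cases ha : G.Adj z u
          · simp [hzu, ha]
            field_simp
          · simp [hzu, ha]
      simp only [Matrix.mulVec, dotProduct, this]
      rw [Finset.sum_sub_distrib, Finset.sum_ite_eq, Finset.sum_ite_mem, Finset.sum_div]
      simp
    rw [h2] at h1
    simp only [Pi.smul_apply, smul_eq_mul] at h1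
    have h3 := (hs z).ne'
    rw [← hss z]
    simp only [hss z]
    field_simp at h1
    field_simp
    linear_combination (-Real.sqrt (G.degree z)) * h1 + (1 - lam i) * w i z * hss z

theorem kemeny_derivative_bounds
    (G : SimpleGraph V) [DecidableRel G.Adj]
    (hdeg : ∀ z : V, 0 < G.degree z)
    (w : Fin (Fintype.card V) → V → ℝ) (lam : Fin (Fintype.card V) → ℝ)
    (horth : ∀ i j, (∑ z, w i z * w j z) = if i = j then 1 else 0)
    (heig : ∀ i, (normLap G).mulVec (w i) = lam i • w i)
    (x y : V) :
    (∑ i, if lam i = 0 then (0 : ℝ) else -2 / lam i ^ 2) +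
        (∑ i, if lam i = 0 then (0 : ℝ) else 1 / lam i) ≤
      kemenyDeriv G w lam x y ∧
    kemenyDeriv G w lam x y ≤ ∑ i, if lam i = 0 then (0 : ℝ) else 1 / lam i := by
  have h := kdata_of G hdeg w lam horth heig
  set g : Fin (Fintype.card V) → V → ℝ := fun i z => w i z / Real.sqrt (G.degree z) with hg
  have hF : ∀ i, edgeDeriv G (w i) (lam i) x y
      = (1 - lam i) * (g i x ^ 2 + g i y ^ 2) - 2 * (g i x * g i y) := by
    intro i
    unfold edgeDeriv
    simp only [hg, div_pow]
    rw [Real.sq_sqrt (by positivity), Real.sq_sqrt (by positivity), Real.sqrt_mul (by positivity),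
      div_mul_div_comm, mul_div_assoc]
  have hK : kemenyDeriv G w lam x y = ∑ i, if lam i = 0 then 0 else
      (g i x ^ 2 + g i y ^ 2) / lam i - (g i x - g i y) ^ 2 / lam i ^ 2 := by
    unfold kemenyDeriv
    apply Finset.sum_congr rfl
    intro i _
    rw [hF]
    split_ifs
    · rfl
    · field_simp
      ring
  have hs : x ≠ y → ∀ i, g i x ^ 2 + g i y ^ 2 ≤ 1 := by
    intro hne i
    have h1 : ∑ z ∈ {x, y}, (G.degree z : ℝ) * g i z ^ 2 ≤ 1 := by
      rw [← h.norm i]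
      exact Finset.sum_le_sum_of_subset_of_nonneg (Finset.subset_univ _)
        (fun z _ _ => by positivity)
    rw [Finset.sum_pair hne] at h1
    nlinarith [h.deg x, h.deg y, sq_nonneg (g i x), sq_nonneg (g i y)]
  rw [hK]
  constructor
  · rw [← Finset.sum_add_distrib]
    apply Finset.sum_le_sum
    intro i _
    have l2 := h.le_two i
    split_ifs with hi
    · simp
    · have hp : 0 < lam i := lt_of_le_of_ne (h.nonneg i) (Ne.symm hi)
      have e1 : -2 / lam i ^ 2 + 1 / lam i = (lam i - 2) / lam i ^ 2 := by
        field_simp; ring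
      have e2 : (g i x ^ 2 + g i y ^ 2) / lam i - (g i x - g i y) ^ 2 / lam i ^ 2
          = (lam i * (g i x ^ 2 + g i y ^ 2) - (g i x - g i y) ^ 2) / lam i ^ 2 := by
        field_simp
      rw [e1, e2]
      apply div_le_div_of_nonneg_right _ (by positivity)
      by_cases hxy : x = y
      · subst hxy
        have : 0 ≤ lam i * (g i x ^ 2 + g i x ^ 2) := by positivity
        simp; linarith
      · nlinarith [hs hxy i, sq_nonneg (g i x + g i y)]
  · by_cases hxy : x = y
    · subst hxy
      refine le_trans (le_of_eq ?_) (h.diag x)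
      apply Finset.sum_congr rfl
      intro i _
      split_ifs
      · rfl
      · ring
    · apply Finset.sum_le_sum
      intro i _
      split_ifs with hi
      · rfl
      · have hp : 0 < lam i := lt_of_le_of_ne (h.nonneg i) (Ne.symm hi)
        have h1 := div_le_div_of_nonneg_right (hs hxy i) hp.le
        have h2 : 0 ≤ (g i x - g i y) ^ 2 / lam i ^ 2 := by positivity
        linarith
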